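/- Let A(s) be an n×n matrix over ℝ[s], let p, q ∈ ℤⁿ be degree-feasible for A(s), and let J be the tight coefficient matrix of A(s) with respect to (p,q). Let U, V be real n×n matrices with U upper-triangular along p and V upper-triangular along q, and define polynomial matrices Ũ_{ik} = U_{ik}·s^{p_k − p_i} if p_i ≤ p_k (and 0 otherwise) and Ṽ_{mj} = V_{mj}·s^{q_j − q_m} if q_m ≤ q_j (and 0 otherwise). Set B(s) = Ũ·A(s)·Ṽ. Then (p,q) is degree-feasible for B(s), i.e., deg B(s)_{ij} ≤ q_j − p_i for all i, j, and the tight coefficient matrix of B(s) with respect to (p,q) equals the real matrix product U·J·V. -/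

import Mathlib

open Matrix Polynomial

noncomputable section

/-- The degree of a polynomial, viewed in `ℤ ∪ {−∞}` (`WithBot ℤ`). -/
def degZ (f : Polynomial ℝ) : WithBot ℤ :=
  f.degree.map (Nat.cast : ℕ → ℤ)

/-- The tight coefficient matrix of a polynomial matrix `A(s)` with respect to `(p, q)`. -/
def tightCoeff (n : ℕ) (A : Matrix (Fin n) (Fin n) (Polynomial ℝ))
    (p q : Fin n → ℤ) : Matrix (Fin n) (Fin n) ℝ :=
  Matrix.of fun i j => if 0 ≤ q j - p i then (A i j).coeff (q j - p i).toNat else 0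

/-- The polynomial matrix `diag(s^{−p_i}) · M · diag(s^{p_i})` associated to a real matrix `M`
upper-triangular along `p`: entry `(i,k)` is `M i k · s^{p_k − p_i}` if `p i ≤ p k`, else `0`. -/
def polyConj (n : ℕ) (p : Fin n → ℤ) (M : Matrix (Fin n) (Fin n) ℝ) :
    Matrix (Fin n) (Fin n) (Polynomial ℝ) :=
  Matrix.of fun i k =>
    if p i ≤ p k then Polynomial.C (M i k) * Polynomial.X ^ (p k - p i).toNat else 0

theorem degZ_le_iff (f : Polynomial ℝ) (d : ℤ) :
    degZ f ≤ (d : WithBot ℤ) ↔ f = 0 ∨ (f.natDegree : ℤ) ≤ d := by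
  by_cases hf : f = 0
  · simp [hf, degZ]
  · rw [degZ, degree_eq_natDegree hf]
    simp only [hf, false_or]
    exact WithBot.coe_le_coe

theorem degZ_le_iff_coeff (f : Polynomial ℝ) (d : ℤ) :
    degZ f ≤ (d : WithBot ℤ) ↔ ∀ k : ℕ, d < k → f.coeff k = 0 := by
  rw [degZ_le_iff]
  constructor
  · rintro (rfl | h) k hk
    · simp
    · exact coeff_eq_zero_of_natDegree_lt (by omega)
  · intro h
    by_contra! hc
    exact hc.1 (leadingCoeff_eq_zero.mp (h _ hc.2))

theorem degZ_sum_le {ι : Type*} (s : Finset ι) (f : ι → Polynomial ℝ) (d : ℤ)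
    (h : ∀ i ∈ s, degZ (f i) ≤ (d : WithBot ℤ)) :
    degZ (∑ i ∈ s, f i) ≤ (d : WithBot ℤ) := by
  simp only [degZ_le_iff_coeff] at h ⊢
  intro k hk
  rw [finsetSum_coeff]
  exact Finset.sum_eq_zero fun i hi => h i hi k hk

theorem degZ_mul_le {f g : Polynomial ℝ} {a b : ℤ}
    (hf : degZ f ≤ (a : WithBot ℤ)) (hg : degZ g ≤ (b : WithBot ℤ)) :
    degZ (f * g) ≤ ((a + b : ℤ) : WithBot ℤ) := by
  rw [degZ_le_iff] at *
  rcases hf with rfl | hf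
  · simp
  rcases hg with rfl | hg
  · simp
  have := natDegree_mul_le (p := f) (q := g)
  right
  omega

/-- The coefficient of `s ^ d` for an integer exponent `d`, zero when `d` is negative. -/
def intCoeff (f : Polynomial ℝ) (d : ℤ) : ℝ :=
  if 0 ≤ d then f.coeff d.toNat else 0

theorem intCoeff_sum {ι : Type*} (s : Finset ι) (f : ι → Polynomial ℝ) (d : ℤ) :
    intCoeff (∑ i ∈ s, f i) d = ∑ i ∈ s, intCoeff (f i) d := by
  unfold intCoeff
  split_ifs <;> simp

theorem intCoeff_mul {f g : Polynomial ℝ} {a b : ℤ}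
    (hf : degZ f ≤ (a : WithBot ℤ)) (hg : degZ g ≤ (b : WithBot ℤ)) :
    intCoeff (f * g) (a + b) = intCoeff f a * intCoeff g b := by
  rw [degZ_le_iff] at hf hg
  rcases hf with rfl | hf
  · simp [intCoeff]
  rcases hg with rfl | hg
  · simp [intCoeff]
  have ha : 0 ≤ a := by omega
  have hb : 0 ≤ b := by omega
  rw [intCoeff, intCoeff, intCoeff, if_pos ha, if_pos hb, if_pos (by omega), Int.toNat_add ha hb]
  exact coeff_mul_add_eq_of_natDegree_le (by omega) (by omega)

theorem tightCoeff_apply (n : ℕ) (A : Matrix (Fin n) (Fin n) (Polynomial ℝ)) (p q : Fin n → ℤ)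
    (i j : Fin n) : tightCoeff n A p q i j = intCoeff (A i j) (q j - p i) :=
  rfl

theorem degZ_matrix_mul_le {n : ℕ} {A B : Matrix (Fin n) (Fin n) (Polynomial ℝ)}
    {p q r : Fin n → ℤ}
    (hA : ∀ i j, degZ (A i j) ≤ ((q j - p i : ℤ) : WithBot ℤ))
    (hB : ∀ i j, degZ (B i j) ≤ ((r j - q i : ℤ) : WithBot ℤ)) (i j : Fin n) :
    degZ ((A * B) i j) ≤ ((r j - p i : ℤ) : WithBot ℤ) := by
  rw [Matrix.mul_apply]
  refine degZ_sum_le _ _ _ fun k _ => ?_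
  have h := degZ_mul_le (hA i k) (hB k j)
  rwa [show q k - p i + (r j - q k) = r j - p i by ring] at h

theorem tightCoeff_mul {n : ℕ} {A B : Matrix (Fin n) (Fin n) (Polynomial ℝ)}
    {p q r : Fin n → ℤ}
    (hA : ∀ i j, degZ (A i j) ≤ ((q j - p i : ℤ) : WithBot ℤ))
    (hB : ∀ i j, degZ (B i j) ≤ ((r j - q i : ℤ) : WithBot ℤ)) :
    tightCoeff n (A * B) p r = tightCoeff n A p q * tightCoeff n B q r := by
  ext i j
  simp only [tightCoeff_apply, Matrix.mul_apply, intCoeff_sum]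
  refine Finset.sum_congr rfl fun k _ => ?_
  rw [← intCoeff_mul (hA i k) (hB k j), show q k - p i + (r j - q k) = r j - p i by ring]

theorem degZ_polyConj_le (n : ℕ) (p : Fin n → ℤ) (M : Matrix (Fin n) (Fin n) ℝ) (i j : Fin n) :
    degZ (polyConj n p M i j) ≤ ((p j - p i : ℤ) : WithBot ℤ) := by
  rw [degZ_le_iff, polyConj, Matrix.of_apply]
  split_ifs with h
  · right
    have := natDegree_C_mul_X_pow_le (M i j) (p j - p i).toNat
    omega
  · exact Or.inl rfl

theorem tightCoeff_polyConj {n : ℕ} {p : Fin n → ℤ} {M : Matrix (Fin n) (Fin n) ℝ}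
    (hM : ∀ i j, p i > p j → M i j = 0) : tightCoeff n (polyConj n p M) p p = M := by
  ext i j
  rw [tightCoeff_apply, intCoeff, polyConj, Matrix.of_apply]
  by_cases h : p i ≤ p j
  · simp [h]
  · simp [h, hM i j (not_le.mp h)]

/-- If `(p,q)` is degree-feasible for `A(s)` with tight coefficient matrix `J`, and `U, V` are
real matrices upper-triangular along `p` and `q` respectively, then for
`B(s) = Ũ·A(s)·Ṽ`, the pair `(p,q)` is degree-feasible for `B(s)`, and the tight coefficient
matrix of `B(s)` is `U·J·V`. -/
theorem stmt_13 (n : ℕ) (A : Matrix (Fin n) (Fin n) (Polynomial ℝ)) (p q : Fin n → ℤ)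
    (hfeas : ∀ i j, degZ (A i j) ≤ ((q j - p i : ℤ) : WithBot ℤ))
    (U V : Matrix (Fin n) (Fin n) ℝ)
    (hU : ∀ i j, p i > p j → U i j = 0) (hV : ∀ i j, q i > q j → V i j = 0) :
    (∀ i j, degZ ((polyConj n p U * A * polyConj n q V) i j) ≤ ((q j - p i : ℤ) : WithBot ℤ)) ∧
    tightCoeff n (polyConj n p U * A * polyConj n q V) p q = U * tightCoeff n A p q * V := by
  have hdU := degZ_polyConj_le n p U
  have hdV := degZ_polyConj_le n q V
  have hUA := degZ_matrix_mul_le hdU hfeas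
  refine ⟨degZ_matrix_mul_le hUA hdV, ?_⟩
  rw [tightCoeff_mul hUA hdV, tightCoeff_mul hdU hfeas, tightCoeff_polyConj hU,
    tightCoeff_polyConj hV]

end
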